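/- Let k be a field, f : X → Y a morphism of schemes of finite type over k, C ⊆ X a constructible subset, and c a natural number. Assume that for every point y ∈ Y the fiber C ∩ f^{-1}(y) (a subset of the topological fiber f^{-1}(y)) is either empty or satisfies dim(C ∩ f^{-1}(y)) + c ≤ dim(f^{-1}(y)), where dim denotes the Krull dimension of the subspace topology. Then dim(C) + c ≤ dim(X), i.e. C has codimension ≥ c in X. -/

import Mathlib

open AlgebraicGeometry CategoryTheory

/-- Every element of `K` is a quotient of elements in the image of `φ`. -/
def RingHom.GeneratesFractions {A K : Type*} [CommRing A] [Field K] (φ : A →+* K) : Prop :=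
  ∀ x : K, ∃ a s : A, φ s ≠ 0 ∧ φ s * x = φ a

universe u

theorem Algebra.trdeg_add_one_le_of_surjective {K R R' : Type u} [Field K] [CommRing R]
    [IsDomain R] [CommRing R'] [IsDomain R'] [Algebra K R] [Algebra K R']
    (π : R →ₐ[K] R') (hπ : Function.Surjective π) (hπ' : ¬ Function.Injective π) :
    Algebra.trdeg K R' + 1 ≤ Algebra.trdeg K R := by
  obtain ⟨s, hs⟩ := exists_isTranscendenceBasis K R'
  choose x hx using fun i : s ↦ hπ i
  have hπx : π ∘ x = ((↑) : s → R') := funext hx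
  have hxi : AlgebraicIndependent K x := by
    refine AlgebraicIndependent.of_ringHom_of_comp_eq (RingHom.id K) (π : R →+* R')
      (S := K) (B := R') ?_ Function.injective_id ?_
    · simpa [hπx] using! hs.1
    · ext; simp
  obtain ⟨p, hp, hp0⟩ : ∃ p, π p = 0 ∧ p ≠ 0 := by
    simpa [injective_iff_map_eq_zero] using hπ'
  have htr : Transcendental (Algebra.adjoin K (Set.range x)) p := by
    intro halg
    obtain ⟨r, hr, q, hq⟩ := halg.exists_nonzero_dvd (mem_nonZeroDivisors_of_ne_zero hp0)
    have h0 : π r = 0 := by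
      rw [show (r : R) = p * q from hq, map_mul, hp, zero_mul]
    obtain ⟨f, hf⟩ := (Algebra.adjoin_range_eq_range_aeval K x).le r.2
    replace hf : MvPolynomial.aeval x f = r := hf
    have hf0 : f = 0 := by
      apply hs.1.eq_zero_of_aeval_eq_zero
      rw [← hπx]
      rw [← hf, ← AlgHom.comp_apply, MvPolynomial.comp_aeval] at h0
      exact h0
    exact hr (Subtype.ext (by rw [← hf, hf0, map_zero]; rfl))
  rw [← hs.cardinalMk_eq_trdeg, ← Cardinal.mk_option]
  exact ((hxi.option_iff_transcendental p).mpr htr).cardinalMk_le_trdeg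

theorem Algebra.trdeg_eq_of_generatesFractions {K R L : Type u} [Field K] [CommRing R] [Field L]
    [Algebra K R] [Algebra R L] [Algebra K L] [IsScalarTower K R L]
    (hinj : Function.Injective (algebraMap R L)) (h : (algebraMap R L).GeneratesFractions) :
    Algebra.trdeg K R = Algebra.trdeg K L := by
  have := (faithfulSMul_iff_algebraMap_injective R L).mpr hinj
  have := hinj.isDomain
  have : Algebra.IsAlgebraic R L := by
    refine ⟨fun x ↦ ?_⟩
    obtain ⟨a, s, hs, hx⟩ := h x
    refine ⟨.C s * .X - .C a, ?_, by simp [hx]⟩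
    intro h0
    have := congr(Polynomial.coeff $h0 1)
    simp [Polynomial.coeff_C] at this
    simp [this] at hs
  rw [← trdeg_add_eq K R (A := L), trdeg_eq_zero (R := R), add_zero]

theorem exists_ltSeries_length_eq_trdeg (K R : Type u) [Field K] [CommRing R] [IsDomain R]
    [Algebra K R] [Algebra.FiniteType K R] :
    ∃ l : LTSeries (PrimeSpectrum R), (l.length : Cardinal) = Algebra.trdeg K R := by
  obtain ⟨n, g, hg, hint⟩ := exists_integral_inj_algHom_of_fg K R
  let := g.toAlgebra
  have : IsScalarTower K (MvPolynomial (Fin n) K) R := .of_algHom g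
  have : Algebra.IsIntegral (MvPolynomial (Fin n) K) R := ⟨hint⟩
  have : FaithfulSMul (MvPolynomial (Fin n) K) R :=
    (faithfulSMul_iff_algebraMap_injective _ _).mpr hg
  have hdim : (n : WithBot ℕ∞) ≤ ringKrullDim (MvPolynomial (Fin n) K) := by
    simp [MvPolynomial.ringKrullDim_of_isNoetherianRing, ringKrullDim_eq_zero_of_field]
  obtain ⟨l, hl⟩ := Order.le_krullDim_iff.mp hdim
  obtain ⟨P, -, hP, hPl⟩ := Ideal.exists_ideal_over_prime_of_isIntegral (S := R)
    l.head.asIdeal ⊥ (by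
      rw [Ideal.comap_bot_of_injective _ (FaithfulSMul.algebraMap_injective _ _)]; exact bot_le)
  have : P.LiesOver l.head.asIdeal := ⟨hPl.symm⟩
  obtain ⟨L, hL, -⟩ := Ideal.exists_ltSeries_of_hasGoingUp l P
  refine ⟨L, ?_⟩
  rw [hL, hl, ← trdeg_add_eq K (MvPolynomial (Fin n) K) (A := R), trdeg_eq_zero (A := R),
    MvPolynomial.trdeg_of_isDomain]
  simp

theorem RingHom.exists_ltSeries_of_generatesFractions {B A KB KA : Type u} [CommRing B]
    [CommRing A] [Field KB] [Field KA] [Algebra B A] [Algebra.FiniteType B A] [Algebra B KB]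
    [Algebra A KA] [Algebra KB KA] [Algebra B KA] [IsScalarTower B A KA] [IsScalarTower B KB KA]
    (hB : (algebraMap B KB).GeneratesFractions) (hA : (algebraMap A KA).GeneratesFractions) :
    ∃ l : LTSeries (PrimeSpectrum A), (l.length : Cardinal) = Algebra.trdeg KB KA ∧
      ∀ i, RingHom.ker (algebraMap A KA) ≤ (l i).asIdeal ∧
        (l i).asIdeal.comap (algebraMap B A) = RingHom.ker (algebraMap B KB) := by
  let R : Subalgebra KB KA := Algebra.adjoin KB (Set.range (algebraMap A KA))
  have hBA (b : B) : algebraMap A KA (algebraMap B A b) = algebraMap KB KA (algebraMap B KB b) := by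
    rw [← IsScalarTower.algebraMap_apply, ← IsScalarTower.algebraMap_apply]
  have hRfrac : (algebraMap R KA).GeneratesFractions := fun x ↦ by
    obtain ⟨a, s, hs, hx⟩ := hA x
    exact ⟨⟨_, Algebra.subset_adjoin ⟨a, rfl⟩⟩, ⟨_, Algebra.subset_adjoin ⟨s, rfl⟩⟩, hs, hx⟩
  have hfin : Algebra.FiniteType KB R := by
    obtain ⟨s, hs⟩ := Algebra.FiniteType.out (R := B) (A := A)
    rw [← Subalgebra.fg_iff_finiteType]
    classical
    refine ⟨s.image (algebraMap A KA), le_antisymm (Algebra.adjoin_mono ?_)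
      (Algebra.adjoin_le ?_)⟩
    · simp only [Finset.coe_image]
      exact Set.image_subset_range _ _
    · rintro _ ⟨a, rfl⟩
      have ha : a ∈ Algebra.adjoin B (s : Set A) := hs ▸ trivial
      induction ha using Algebra.adjoin_induction with
      | mem x hx => exact Algebra.subset_adjoin (by simpa using ⟨x, hx, rfl⟩)
      | algebraMap b =>
        rw [SetLike.mem_coe, hBA]
        exact Subalgebra.algebraMap_mem _ _
      | add x y _ _ hx hy => rw [map_add]; exact add_mem hx hy
      | mul x y _ _ hx hy => rw [map_mul]; exact mul_mem hx hy
  have hden (r : KA) (hr : r ∈ R) : ∃ (b : B) (a : A), algebraMap B KB b ≠ 0 ∧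
      algebraMap A KA (algebraMap B A b) * r = algebraMap A KA a := by
    induction hr using Algebra.adjoin_induction with
    | mem x hx =>
      obtain ⟨a, rfl⟩ := hx
      exact ⟨1, a, by simp, by simp⟩
    | algebraMap x =>
      obtain ⟨b, s, hs, hx⟩ := hB x
      exact ⟨s, algebraMap B A b, hs, by rw [hBA, hBA, ← map_mul, hx]⟩
    | add x y _ _ hx hy =>
      obtain ⟨b, a, hb, hx⟩ := hx
      obtain ⟨c, d, hc, hy⟩ := hy
      refine ⟨b * c, algebraMap B A c * a + algebraMap B A b * d, by simp [hb, hc], ?_⟩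
      simp only [map_mul, map_add, ← hx, ← hy]
      ring
    | mul x y _ _ hx hy =>
      obtain ⟨b, a, hb, hx⟩ := hx
      obtain ⟨c, d, hc, hy⟩ := hy
      refine ⟨b * c, a * d, by simp [hb, hc], ?_⟩
      simp only [map_mul, ← hx, ← hy]
      ring
  let φ : A →+* R := (algebraMap A KA).codRestrict R fun a ↦ Algebra.subset_adjoin ⟨a, rfl⟩
  have hφ (b : B) : φ (algebraMap B A b) = algebraMap KB R (algebraMap B KB b) :=
    Subtype.ext (hBA b)
  have hmono : StrictMono (PrimeSpectrum.comap φ) := by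
    refine Monotone.strictMono_of_injective (fun _ _ h ↦ Ideal.comap_mono h) ?_
    have aux (P Q : PrimeSpectrum R) (h : PrimeSpectrum.comap φ P = PrimeSpectrum.comap φ Q) :
        P ≤ Q := by
      intro r hr
      obtain ⟨b, a, hb, ha⟩ := hden r r.2
      have hφa : φ (algebraMap B A b) * r = φ a := Subtype.ext ha
      have hu : IsUnit (φ (algebraMap B A b)) := by
        rw [hφ]
        exact (IsUnit.mk0 _ hb).map _
      have haP : a ∈ (PrimeSpectrum.comap φ P).asIdeal :=
        show φ a ∈ P.asIdeal from hφa ▸ Ideal.mul_mem_left _ _ hr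
      rw [h] at haP
      replace haP : φ a ∈ Q.asIdeal := haP
      rwa [← hφa, Ideal.unit_mul_mem_iff_mem _ hu] at haP
    exact fun P Q h ↦ le_antisymm (aux P Q h) (aux Q P h.symm)
  obtain ⟨l, hl⟩ := exists_ltSeries_length_eq_trdeg KB R
  refine ⟨l.map _ hmono, ?_, fun i ↦ ⟨fun a ha ↦ ?_, ?_⟩⟩
  · rw [← Algebra.trdeg_eq_of_generatesFractions Subtype.val_injective hRfrac]
    exact hl
  · have : φ a = 0 := Subtype.ext ha
    change φ a ∈ (l i).asIdeal
    simp [this]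
  · ext b
    change φ (algebraMap B A b) ∈ (l i).asIdeal ↔ _
    rw [hφ, RingHom.mem_ker, ← Ideal.mem_comap, Ideal.eq_bot_of_prime (Ideal.comap _ _),
      Ideal.mem_bot]


theorem le_topologicalKrullDim_of_specializes {Z : Type*} [TopologicalSpace Z] [T0Space Z]
    {n : ℕ} (x : Fin (n + 1) → Z)
    (hx : ∀ i : Fin n, x i.castSucc ⤳ x i.succ ∧ x i.castSucc ≠ x i.succ) :
    (n : WithBot ℕ∞) ≤ topologicalKrullDim Z := by
  let F : Fin (n + 1) → (TopologicalSpace.IrreducibleCloseds Z)ᵒᵈ := fun i ↦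
    OrderDual.toDual ⟨closure {x i}, isIrreducible_singleton.closure, isClosed_closure⟩
  have hF : StrictMono F := by
    refine Fin.strictMono_iff_lt_succ.mpr fun i ↦ ?_
    obtain ⟨h, hne⟩ := hx i
    refine lt_of_le_not_ge ?_ ?_
    · exact specializes_iff_closure_subset.mp h
    · intro h'
      exact hne (h.antisymm (specializes_iff_closure_subset.mpr h')).eq
  rw [topologicalKrullDim, ← Order.krullDim_orderDual]
  exact Order.le_krullDim_iff.mpr ⟨⟨n, F, fun i ↦ hF i.castSucc_lt_succ⟩, rfl⟩

/-- A cardinal-valued function that drops along strict specializations bounds the dimension. -/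
theorem exists_add_le_of_le_topologicalKrullDim {Z : Type*} [TopologicalSpace Z] [QuasiSober Z]
    (d : Z → Cardinal) (hd : ∀ x x', x ⤳ x' → ¬ x' ⤳ x → d x' + 1 ≤ d x)
    (m : Cardinal) (hm : ∀ z, m ≤ d z) (n : ℕ) (hn : (n : WithBot ℕ∞) ≤ topologicalKrullDim Z) :
    ∃ x, m + n ≤ d x := by
  obtain ⟨l, rfl⟩ := Order.le_krullDim_iff.mp hn
  have key : ∀ i : ℕ, ∀ hi : i < l.length + 1, m + i ≤ d (l ⟨i, hi⟩).2.genericPoint := by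
    intro i
    induction i with
    | zero => intro hi; simpa using hm _
    | succ i ih =>
      intro hi
      have hlt : l ⟨i, by omega⟩ < l ⟨i + 1, hi⟩ := l.strictMono (Fin.mk_lt_mk.mpr (by omega))
      have hg (j) := (l j).2.isGenericPoint_genericPoint (l j).3
      refine le_trans ?_ (hd _ (l ⟨i, by omega⟩).2.genericPoint ?_ ?_)
      · rw [Nat.cast_succ, ← add_assoc]
        gcongr
        exact ih _
      · rw [specializes_iff_mem_closure, (hg _).def]
        exact hlt.le ((hg _).mem)
      · intro h
        refine hlt.not_ge ?_
        have := specializes_iff_closure_subset.mp h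
        rwa [(hg _).def, (hg _).def] at this
  exact ⟨_, key l.length (by omega)⟩

theorem quasiSober_of_finset_isLocallyClosed {X : Type*} [TopologicalSpace X] [QuasiSober X]
    (s : Finset (Set X)) (hs : ∀ U ∈ s, IsLocallyClosed U) :
    QuasiSober (⋃₀ (s : Set (Set X)) : Set X) := by
  refine ⟨fun {S} hS hSc ↦ ?_⟩
  have hT : IsIrreducible (Subtype.val '' S : Set X) :=
    hS.image _ continuous_subtype_val.continuousOn
  obtain ⟨Z, hZ, hTZ⟩ := isIrreducible_iff_sUnion_isClosed.mp hT
    (s.image fun U ↦ closure (U ∩ Subtype.val '' S)) (by simp) (by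
      rintro _ ⟨x, hx, rfl⟩
      obtain ⟨U, hU, hxU⟩ := x.2
      exact ⟨_, Finset.mem_image_of_mem _ hU, subset_closure ⟨hxU, ⟨x, hx, rfl⟩⟩⟩)
  obtain ⟨U, hU, rfl⟩ := Finset.mem_image.mp hZ
  obtain ⟨V, F, hV, hF, rfl⟩ := hs U hU
  obtain ⟨g, hg⟩ := QuasiSober.sober hT.closure isClosed_closure
  have hgF : g ∈ F := by
    have : closure (Subtype.val '' S) ⊆ F := closure_minimal
      (hTZ.trans (closure_minimal (fun x hx ↦ hx.1.2) hF)) hF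
    exact this hg.mem
  have hgV : g ∈ V := by
    obtain ⟨x, hx⟩ := closure_nonempty_iff.mp (hT.nonempty.mono hTZ)
    exact (hg.mem_open_set_iff hV).mpr ⟨x, subset_closure hx.2, hx.1.1⟩
  refine ⟨⟨g, V ∩ F, hU, hgV, hgF⟩, ?_⟩
  rw [isGenericPoint_def, Topology.IsInducing.subtypeVal.closure_eq_preimage_closure_image,
    Set.image_singleton, hg.def, ← Topology.IsInducing.subtypeVal.closure_eq_preimage_closure_image,
    hSc.closure_eq]

theorem WithBot.add_natCast_le_of_forall_natCast_le {a b : WithBot ℕ∞} (c : ℕ)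
    (h : ∀ n : ℕ, n ≤ a → ((n + c : ℕ) : WithBot ℕ∞) ≤ b) : a + c ≤ b := by
  induction a with
  | bot => simp
  | coe a =>
    induction a with
    | top =>
      have hb : ∀ n : ℕ, (n : WithBot ℕ∞) ≤ b := fun n ↦
        le_trans (by exact_mod_cast Nat.le_add_right n c) (h n (by exact_mod_cast le_top))
      induction b with
      | bot => simpa using hb 0
      | coe b =>
        have : b = ⊤ := ENat.eq_top_iff_forall_ge.mpr fun n ↦ by exact_mod_cast hb n
        rw [this]
        exact_mod_cast le_top
    | coe n => exact_mod_cast h n le_rfl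

theorem Algebra.trdeg_eq_trdeg_quotient_ker {K A L : Type u} [Field K] [CommRing A] [Field L]
    [Algebra K A] [Algebra K L] (φ : A →ₐ[K] L) (h : (φ : A →+* L).GeneratesFractions) :
    Algebra.trdeg K (A ⧸ RingHom.ker φ) = Algebra.trdeg K L := by
  let := (Ideal.kerLiftAlg φ).toAlgebra
  have : IsScalarTower K (A ⧸ RingHom.ker φ) L := .of_algHom (Ideal.kerLiftAlg φ)
  refine Algebra.trdeg_eq_of_generatesFractions (Ideal.kerLiftAlg_injective φ) fun x ↦ ?_
  obtain ⟨a, s, hs, hx⟩ := h x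
  exact ⟨Ideal.Quotient.mk _ a, Ideal.Quotient.mk _ s, hs, hx⟩

theorem Algebra.trdeg_add_one_le_of_ker_lt_ker {K A L L' : Type u} [Field K] [CommRing A] [Field L]
    [Field L'] [Algebra K A] [Algebra K L] [Algebra K L'] (φ : A →ₐ[K] L) (φ' : A →ₐ[K] L')
    (h : (φ : A →+* L).GeneratesFractions) (h' : (φ' : A →+* L').GeneratesFractions)
    (hlt : RingHom.ker φ < RingHom.ker φ') :
    Algebra.trdeg K L' + 1 ≤ Algebra.trdeg K L := by
  have := RingHom.ker_isPrime φ
  have := RingHom.ker_isPrime φ'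
  rw [← Algebra.trdeg_eq_trdeg_quotient_ker φ h, ← Algebra.trdeg_eq_trdeg_quotient_ker φ' h']
  refine Algebra.trdeg_add_one_le_of_surjective (Ideal.Quotient.factorₐ K hlt.le)
    (Ideal.Quotient.factor_surjective hlt.le) fun hinj ↦ hlt.not_ge fun a ha ↦ ?_
  rw [← Ideal.Quotient.eq_zero_iff_mem] at ha ⊢
  exact hinj (ha.trans (map_zero _).symm)


namespace AlgebraicGeometry

theorem Scheme.map_evaluation {X : Scheme.{u}} {U V : X.Opens} (i : U ≤ V) (x : X) (hx : x ∈ U) :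
    X.presheaf.map (homOfLE i).op ≫ X.evaluation U x hx = X.evaluation V x (i hx) :=
  X.presheaf.germ_res_assoc (homOfLE i) x hx (X.residue x)

theorem IsAffineOpen.fromSpec_specializes {X : Scheme.{u}} {U : X.Opens} (hU : IsAffineOpen U)
    {p q : Spec Γ(X, U)} (h : p ⤳ q) : hU.fromSpec p ⤳ hU.fromSpec q :=
  h.map hU.fromSpec.continuous

theorem IsAffineOpen.map_fromSpec_eq {X Y : Scheme.{u}} (f : X ⟶ Y) {W : Y.Opens} {U : X.Opens}
    (hW : IsAffineOpen W) (hU : IsAffineOpen U) (i : U ≤ f ⁻¹ᵁ W) (p : Spec Γ(X, U)) :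
    f (hU.fromSpec p) = hW.fromSpec (Spec.map (f.appLE W U i) p) :=
  congr($(IsAffineOpen.SpecMap_appLE_fromSpec f hW hU i) p).symm

theorem IsAffineOpen.ker_evaluation {X : Scheme.{u}} {U : X.Opens} (hU : IsAffineOpen U) (x : X)
    (hx : x ∈ U) :
    RingHom.ker (X.evaluation U x hx).hom = (hU.primeIdealOf ⟨x, hx⟩).asIdeal := by
  ext a
  rw [hU.primeIdealOf_eq_map_closedPoint]
  exact IsLocalRing.residue_eq_zero_iff (X.presheaf.germ U x hx a)

theorem IsAffineOpen.generatesFractions_evaluation {X : Scheme.{u}} {U : X.Opens}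
    (hU : IsAffineOpen U) (x : X) (hx : x ∈ U) :
    (X.evaluation U x hx).hom.GeneratesFractions := by
  intro y
  obtain ⟨y, rfl⟩ := X.residue_surjective x y
  have := hU.isLocalization_stalk ⟨x, hx⟩
  let := X.presheaf.algebra_section_stalk ⟨x, hx⟩
  obtain ⟨a, s, h⟩ := IsLocalization.exists_mk'_eq (hU.primeIdealOf ⟨x, hx⟩).asIdeal.primeCompl y
  refine ⟨a, s, ?_, ?_⟩
  · exact fun h0 ↦ s.2 ((hU.ker_evaluation x hx).le h0)
  · rw [← h]
    have := IsLocalization.mk'_spec' (X.presheaf.stalk x) a s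
    exact (map_mul (X.residue x).hom _ _).symm.trans congr(X.residue x $this)

/-- The transcendence degree of `κ(x)` over `κ(f x)`. -/
noncomputable def Scheme.Hom.relTrdeg {X Y : Scheme.{u}} (f : X ⟶ Y) (x : X) : Cardinal.{u} :=
  letI := (f.residueFieldMap x).hom.toAlgebra
  Algebra.trdeg (Y.residueField (f x)) (X.residueField x)

/-- The structure map `k → κ(x)` of a `k`-scheme. -/
noncomputable def residueFieldOfField {k : Type u} [Field k] {X : Scheme.{u}}
    (s : X ⟶ Spec (.of k)) (x : X) : k →+* X.residueField x :=
  ((Scheme.ΓSpecIso (.of k)).inv ≫ s.appTop ≫ X.Γevaluation x).hom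

/-- The transcendence degree of `κ(x)` over `k`. -/
noncomputable def absTrdeg {k : Type u} [Field k] {X : Scheme.{u}}
    (s : X ⟶ Spec (.of k)) (x : X) : Cardinal.{u} :=
  letI := (residueFieldOfField s x).toAlgebra
  Algebra.trdeg k (X.residueField x)

theorem residueFieldOfField_comp {k : Type u} [Field k] {X Y : Scheme.{u}} (f : X ⟶ Y)
    (s : Y ⟶ Spec (.of k)) (x : X) :
    residueFieldOfField (f ≫ s) x =
      (f.residueFieldMap x).hom.comp (residueFieldOfField s (f x)) := by
  rw [residueFieldOfField, residueFieldOfField, ← CommRingCat.hom_comp]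
  congr 1
  rw [Category.assoc, Category.assoc, Scheme.Γevaluation_naturality, Scheme.Hom.comp_appTop,
    Category.assoc]

theorem absTrdeg_comp {k : Type u} [Field k] {X Y : Scheme.{u}} (f : X ⟶ Y)
    (s : Y ⟶ Spec (.of k)) (x : X) :
    absTrdeg (f ≫ s) x = absTrdeg s (f x) + f.relTrdeg x := by
  let := (residueFieldOfField (f ≫ s) x).toAlgebra
  let := (residueFieldOfField s (f x)).toAlgebra
  let := (f.residueFieldMap x).hom.toAlgebra
  have : IsScalarTower k (Y.residueField (f x)) (X.residueField x) :=
    .of_algebraMap_eq' (residueFieldOfField_comp f s x)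
  exact (trdeg_add_eq k (Y.residueField (f x)) (A := X.residueField x)).symm

theorem absTrdeg_id {k : Type u} [Field k] (y : Spec (.of k)) :
    absTrdeg (𝟙 (Spec (.of k))) y = 0 := by
  let := (residueFieldOfField (𝟙 (Spec (.of k))) y).toAlgebra
  have h : (algebraMap k ((Spec (.of k)).residueField y)).GeneratesFractions := by
    intro x
    obtain ⟨a, s, hs, hx⟩ :=
      (isAffineOpen_top (Spec (.of k))).generatesFractions_evaluation y trivial x
    have key (a) : algebraMap k ((Spec (.of k)).residueField y)
        ((Scheme.ΓSpecIso (.of k)).hom a) = (Spec (.of k)).Γevaluation y a := by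
      change (Spec (.of k)).Γevaluation y ((Scheme.Hom.appTop (𝟙 _))
        ((Scheme.ΓSpecIso (.of k)).inv ((Scheme.ΓSpecIso (.of k)).hom a))) = _
      simp
    refine ⟨(Scheme.ΓSpecIso (.of k)).hom a, (Scheme.ΓSpecIso (.of k)).hom s, ?_, ?_⟩
    · rw [key]; exact hs
    · rw [key, key]; exact hx
  have := Algebra.trdeg_eq_of_generatesFractions (K := k) (R := k)
    (algebraMap k ((Spec (.of k)).residueField y)).injective h
  rw [trdeg_eq_zero (R := k) (A := k)] at this
  exact this.symm

theorem absTrdeg_eq_relTrdeg {k : Type u} [Field k] {X : Scheme.{u}} (s : X ⟶ Spec (.of k))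
    (x : X) : absTrdeg s x = s.relTrdeg x := by
  simpa [absTrdeg_id] using absTrdeg_comp s (𝟙 _) x

theorem residueFieldOfField_eq {k : Type u} [Field k] {X : Scheme.{u}} (s : X ⟶ Spec (.of k))
    {U : X.Opens} (x : X) (hx : x ∈ U) : residueFieldOfField s x =
      (X.evaluation U x hx).hom.comp
        ((Scheme.ΓSpecIso (.of k)).inv ≫ s.appTop ≫ X.presheaf.map (homOfLE le_top).op).hom := by
  rw [residueFieldOfField, ← CommRingCat.hom_comp]
  congr 1
  rw [Category.assoc, Category.assoc, Scheme.map_evaluation]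

theorem absTrdeg_add_one_le {k : Type u} [Field k] {X : Scheme.{u}} (s : X ⟶ Spec (.of k))
    {x x' : X} (h : x ⤳ x') (hne : x ≠ x') : absTrdeg s x' + 1 ≤ absTrdeg s x := by
  obtain ⟨U, hU, hx', -⟩ := exists_isAffineOpen_mem_and_subset (X := X) (x := x') (U := ⊤) trivial
  have hx : x ∈ U := h.mem_open U.2 hx'
  let ρ := ((Scheme.ΓSpecIso (.of k)).inv ≫ s.appTop ≫
    X.presheaf.map (homOfLE (le_top : U ≤ ⊤)).op).hom
  let := ρ.toAlgebra
  let := (residueFieldOfField s x).toAlgebra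
  let := (residueFieldOfField s x').toAlgebra
  let φ : Γ(X, U) →ₐ[k] X.residueField x :=
    { (X.evaluation U x hx).hom with
      commutes' a := congr($(residueFieldOfField_eq s x hx) a).symm }
  let φ' : Γ(X, U) →ₐ[k] X.residueField x' :=
    { (X.evaluation U x' hx').hom with
      commutes' a := congr($(residueFieldOfField_eq s x' hx') a).symm }
  have hφ (a) : φ a = 0 ↔ x ∉ X.basicOpen a := X.evaluation_eq_zero_iff_notMem_basicOpen x hx a
  have hφ' (a) : φ' a = 0 ↔ x' ∉ X.basicOpen a :=
    X.evaluation_eq_zero_iff_notMem_basicOpen x' hx' a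
  have hle : RingHom.ker φ ≤ RingHom.ker φ' := by
    intro a ha
    rw [RingHom.mem_ker] at ha ⊢
    rw [hφ] at ha
    rw [hφ']
    exact fun h' ↦ ha (h.mem_open (X.basicOpen a).2 h')
  have hkne : RingHom.ker φ ≠ RingHom.ker φ' := by
    intro heq
    refine hne ?_
    have : hU.primeIdealOf ⟨x, hx⟩ = hU.primeIdealOf ⟨x', hx'⟩ := by
      ext1
      rw [← hU.ker_evaluation, ← hU.ker_evaluation]
      exact heq
    have := congr(hU.fromSpec $this)
    rwa [hU.fromSpec_primeIdealOf, hU.fromSpec_primeIdealOf] at this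
  exact Algebra.trdeg_add_one_le_of_ker_lt_ker φ φ' (hU.generatesFractions_evaluation x hx)
    (hU.generatesFractions_evaluation x' hx') (lt_of_le_of_ne hle hkne)

/-- Every point `x` is the start of a chain of specializations in the fibre of `f` through `x`
whose length is the transcendence degree of `κ(x)` over `κ(f x)`. -/
theorem Scheme.Hom.exists_specializes_chain {X Y : Scheme.{u}} (f : X ⟶ Y) [LocallyOfFiniteType f]
    (x : X) (V : X.Opens) (hxV : x ∈ V) :
    ∃ (n : ℕ) (p : Fin (n + 1) → X), (n : Cardinal) = f.relTrdeg x ∧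
      (∀ i, p i ∈ V ∧ x ⤳ p i ∧ f (p i) = f x) ∧
      ∀ i : Fin n, p i.castSucc ⤳ p i.succ ∧ p i.castSucc ≠ p i.succ := by
  obtain ⟨W, hW, hfx, -⟩ :=
    exists_isAffineOpen_mem_and_subset (X := Y) (x := f x) (U := ⊤) trivial
  obtain ⟨U, hU, hx, hUV⟩ :=
    exists_isAffineOpen_mem_and_subset (X := X) (x := x) (U := V ⊓ f ⁻¹ᵁ W) ⟨hxV, hfx⟩
  have hUW : U ≤ f ⁻¹ᵁ W := fun z hz ↦ (hUV hz).2
  let := (f.appLE W U hUW).hom.toAlgebra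
  let := (Y.evaluation W (f x) hfx).hom.toAlgebra
  let := (X.evaluation U x hx).hom.toAlgebra
  let := (f.residueFieldMap x).hom.toAlgebra
  let := ((f.residueFieldMap x).hom.comp (Y.evaluation W (f x) hfx).hom).toAlgebra
  have : IsScalarTower Γ(Y, W) (Y.residueField (f x)) (X.residueField x) :=
    .of_algebraMap_eq' rfl
  have : IsScalarTower Γ(Y, W) Γ(X, U) (X.residueField x) := .of_algebraMap_eq' <| by
    change (Y.evaluation W (f x) hfx ≫ f.residueFieldMap x).hom =
      (f.appLE W U hUW ≫ X.evaluation U x hx).hom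
    rw [Scheme.Hom.appLE, Category.assoc, Scheme.map_evaluation hUW]
    exact congr(($(Scheme.evaluation_naturality f x hfx)).hom)
  have : Algebra.FiniteType Γ(Y, W) Γ(X, U) := f.finiteType_appLE hW hU hUW
  obtain ⟨l, hl, hlp⟩ := RingHom.exists_ltSeries_of_generatesFractions
    (hW.generatesFractions_evaluation (f x) hfx) (hU.generatesFractions_evaluation x hx)
  refine ⟨l.length, fun i ↦ hU.fromSpec (l i), hl, fun i ↦ ⟨?_, ?_, ?_⟩, fun i ↦ ⟨?_, ?_⟩⟩
  · refine (hUV (?_ : hU.fromSpec (l i) ∈ U)).1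
    rw [← SetLike.mem_coe, ← hU.range_fromSpec]
    exact ⟨_, rfl⟩
  · have h : hU.primeIdealOf ⟨x, hx⟩ ≤ l i := (hU.ker_evaluation x hx).ge.trans (hlp i).1
    have := hU.fromSpec_specializes ((PrimeSpectrum.le_iff_specializes _ _).mp h)
    rwa [hU.fromSpec_primeIdealOf] at this
  · have h : Spec.map (f.appLE W U hUW) (l i) = hW.primeIdealOf ⟨f x, hfx⟩ :=
      PrimeSpectrum.ext ((hlp i).2.trans (hW.ker_evaluation (f x) hfx))
    refine (hW.map_fromSpec_eq f hU hUW (l i)).trans ?_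
    rw [h, hW.fromSpec_primeIdealOf]
  · exact hU.fromSpec_specializes
      ((PrimeSpectrum.le_iff_specializes _ _).mp (show l i.castSucc < l i.succ from l.step i).le)
  · exact fun h ↦ (show l i.castSucc < l i.succ from l.step i).ne
      (hU.fromSpec.isOpenEmbedding.injective h)

end AlgebraicGeometry

theorem AlgebraicGeometry.exists_add_le_absTrdeg {k : Type u} [Field k] {X : Scheme.{u}}
    (s : X ⟶ Spec (.of k)) (Z : Set X) [QuasiSober Z] (m : Cardinal)
    (hm : ∀ z ∈ Z, m ≤ absTrdeg s z) (n : ℕ) (hn : (n : WithBot ℕ∞) ≤ topologicalKrullDim Z) :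
    ∃ x ∈ Z, m + n ≤ absTrdeg s x := by
  obtain ⟨x, hx⟩ := exists_add_le_of_le_topologicalKrullDim (Z := Z) (fun z ↦ absTrdeg s z)
    (fun x x' h h' ↦ absTrdeg_add_one_le s (h.map continuous_subtype_val) fun heq ↦
      h' (Subtype.ext heq ▸ specializes_rfl)) m (fun z ↦ hm z z.2) n hn
  exact ⟨x, x.2, hx⟩

/-- **Statement 18.** Let `k` be a field and `f : X → Y` a morphism of schemes of finite type
over `k`.  Let `C ⊆ X` be a constructible subset (a finite union of locally closed subsets)
and `c` a natural number.  If for every point `y ∈ Y` the fiber `C ∩ f⁻¹(y)` is empty or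
satisfies `dim (C ∩ f⁻¹(y)) + c ≤ dim (f⁻¹(y))`, then `dim C + c ≤ dim X`, i.e. `C` has
codimension `≥ c` in `X`.  (Dimensions are Krull dimensions of subspace topologies,
fibers are topological preimages of points.) -/
theorem stmt18 (k : Type) [Field k] (X Y : Scheme)
    (sX : X ⟶ Spec (CommRingCat.of k)) (sY : Y ⟶ Spec (CommRingCat.of k))
    [LocallyOfFiniteType sX] [QuasiCompact sX]
    [LocallyOfFiniteType sY] [QuasiCompact sY]
    (f : X ⟶ Y) (hf : f ≫ sY = sX)
    (C : Set X)
    (hC : ∃ s : Finset (Set X), (∀ U ∈ s, IsLocallyClosed U) ∧ C = ⋃₀ ↑s)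
    (c : ℕ)
    (hfib : ∀ y : Y, C ∩ ⇑f.base ⁻¹' {y} = ∅ ∨
      topologicalKrullDim ↥(C ∩ ⇑f.base ⁻¹' {y}) + (c : WithBot ℕ∞) ≤
        topologicalKrullDim ↥(⇑f.base ⁻¹' {y})) :
    topologicalKrullDim C + (c : WithBot ℕ∞) ≤ topologicalKrullDim X := by
  subst hf
  refine WithBot.add_natCast_le_of_forall_natCast_le c fun n hn ↦ ?_
  obtain ⟨s, hs, rfl⟩ := hC
  have := quasiSober_of_finset_isLocallyClosed s hs
  obtain ⟨x, hxC, hx⟩ := exists_add_le_absTrdeg (f ≫ sY) _ 0 (fun _ _ ↦ zero_le) n hn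
  obtain ⟨U, hU, hxU⟩ := hxC
  obtain ⟨V, F, hV, hF, rfl⟩ := hs U hU
  have : LocallyOfFiniteType f := locallyOfFiniteType_of_comp f sY
  obtain ⟨e, p, he, hp, hchain⟩ := f.exists_specializes_chain x ⟨V, hV⟩ hxU.1
  have hpC (i) : p i ∈ ⋃₀ (s : Set (Set X)) ∩ f ⁻¹' {f x} :=
    ⟨⟨_, hU, (hp i).1, (hp i).2.1.mem_closed hF hxU.2⟩, (hp i).2.2⟩
  have hle : (e : WithBot ℕ∞) ≤
      topologicalKrullDim ↥(⋃₀ (s : Set (Set X)) ∩ f ⁻¹' {f x}) :=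
    le_topologicalKrullDim_of_specializes (fun i ↦ ⟨p i, hpC i⟩) fun i ↦
      ⟨Topology.IsInducing.subtypeVal.specializes_iff.mp (hchain i).1,
        fun h ↦ (hchain i).2 congr(($h).1)⟩
  have hfx : ((e + c : ℕ) : WithBot ℕ∞) ≤ topologicalKrullDim ↥(f ⁻¹' {f x}) := by
    push_cast
    refine (add_le_add_left hle _).trans ((hfib (f x)).resolve_left ?_)
    exact Set.Nonempty.ne_empty ⟨_, hpC 0⟩
  have : QuasiSober ↥(f ⁻¹' {f x}) := (f.fiberHomeo (f x)).symm.isClosedEmbedding.quasiSober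
  obtain ⟨x', -, hx'⟩ := exists_add_le_absTrdeg (f ≫ sY) (f ⁻¹' {f x}) (absTrdeg sY (f x))
    (fun z hz ↦ by
      rw [absTrdeg_comp, show f z = f x from hz]
      exact le_self_add) (e + c) hfx
  obtain ⟨N, q, hN, -, hq⟩ := (f ≫ sY).exists_specializes_chain x' ⊤ trivial
  refine le_trans ?_ (le_topologicalKrullDim_of_specializes q hq)
  rw [absTrdeg_comp, ← he, zero_add] at hx
  rw [absTrdeg_eq_relTrdeg (f ≫ sY), ← hN, Nat.cast_add, ← add_assoc] at hx'
  have : ((n + c : ℕ) : Cardinal) ≤ N := by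
    push_cast
    exact (add_le_add_left hx _).trans hx'
  exact_mod_cast this
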